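/- Let K be a field, n ≥ 2 an integer, and q, t ∈ Kˣ with q^m ≠ 1 and t^m ≠ 1 for all integers m ≥ 1. Let M be an H_{q,t}(GL_n)-module that is simple and Y-semisimple, and let z = (z_1,…,z_n) ∈ supp(M). Then: (1) for 1 ≤ i ≤ n−1, M[s_i·z] = 0 if and only if z_i/z_{i+1} ∈ {t², t⁻²}, and T_i·M[z] ⊆ M[z] + M[s_i·z]; (2) M[s_0·z] = 0 if and only if q·z_n/z_1 ∈ {t², t⁻²}, and T_0·M[z] ⊆ M[z] + M[s_0·z]; (3) M[π·z] ≠ 0, and π·M[z] = M[π·z]. -/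

import Mathlib

noncomputable section

/-- Generators of the double affine Hecke algebra `H_{q,t}(GL_n)`:
`T_i` for `i ∈ ℤ/nℤ`, `π` and its inverse, and `Y_1, …, Y_n` and their inverses
(the generator `Y` with `Fin` index `a` corresponds to `Y_{a+1}`). -/
inductive DGen (n : ℕ) : Type where
  | T : ZMod n → DGen n
  | P : DGen n
  | Pinv : DGen n
  | Y : Fin n → DGen n
  | Yinv : Fin n → DGen n

abbrev FA (K : Type*) [Field K] (n : ℕ) := FreeAlgebra K (DGen n)

def gT (K : Type*) [Field K] (n : ℕ) (i : ZMod n) : FA K n := FreeAlgebra.ι K (DGen.T i)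
def gP (K : Type*) [Field K] (n : ℕ) : FA K n := FreeAlgebra.ι K DGen.P
def gPinv (K : Type*) [Field K] (n : ℕ) : FA K n := FreeAlgebra.ι K DGen.Pinv
def gY (K : Type*) [Field K] (n : ℕ) (i : Fin n) : FA K n := FreeAlgebra.ι K (DGen.Y i)
def gYinv (K : Type*) [Field K] (n : ℕ) (i : Fin n) : FA K n := FreeAlgebra.ι K (DGen.Yinv i)
def sc (K : Type*) [Field K] (n : ℕ) (c : K) : FA K n := algebraMap K (FA K n) c

/-- The defining relations of the double affine Hecke algebra `H_{q,t}(GL_n)`. -/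
inductive DahaRel (K : Type*) [Field K] (n : ℕ) (q t : Kˣ) : FA K n → FA K n → Prop where
  | hecke (i : ZMod n) :
      DahaRel K n q t
        ((gT K n i - sc K n (t : K)) * (gT K n i + sc K n ((t⁻¹ : Kˣ) : K))) 0
  | braid (i : ZMod n) :
      DahaRel K n q t (gT K n i * gT K n (i + 1) * gT K n i)
        (gT K n (i + 1) * gT K n i * gT K n (i + 1))
  | tcomm (i j : ZMod n) (h1 : j ≠ i + 1) (h2 : i ≠ j + 1) :
      DahaRel K n q t (gT K n i * gT K n j) (gT K n j * gT K n i)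
  | pPinv : DahaRel K n q t (gP K n * gPinv K n) 1
  | pinvP : DahaRel K n q t (gPinv K n * gP K n) 1
  | ycomm (i j : Fin n) : DahaRel K n q t (gY K n i * gY K n j) (gY K n j * gY K n i)
  | yYinv (i : Fin n) : DahaRel K n q t (gY K n i * gYinv K n i) 1
  | yinvY (i : Fin n) : DahaRel K n q t (gYinv K n i * gY K n i) 1
  | ptp (i : ZMod n) :
      DahaRel K n q t (gP K n * gT K n i * gPinv K n) (gT K n (i + 1))
  | tyt (a b : Fin n) (h : (b : ℕ) = (a : ℕ) + 1) :
      DahaRel K n q t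
        (gT K n (((a : ℕ) + 1 : ℕ) : ZMod n) * gY K n a * gT K n (((a : ℕ) + 1 : ℕ) : ZMod n))
        (gY K n b)
  | t0yt0 (a b : Fin n) (ha : (a : ℕ) = n - 1) (hb : (b : ℕ) = 0) :
      DahaRel K n q t (gT K n 0 * gY K n a * gT K n 0)
        (sc K n ((q⁻¹ : Kˣ) : K) * gY K n b)
  | tycomm (i : ZMod n) (a : Fin n)
      (h1 : (((a : ℕ) + 1 : ℕ) : ZMod n) ≠ i) (h2 : (((a : ℕ) + 1 : ℕ) : ZMod n) ≠ i + 1) :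
      DahaRel K n q t (gT K n i * gY K n a) (gY K n a * gT K n i)
  | pyp (a b : Fin n) (h : (b : ℕ) = (a : ℕ) + 1) :
      DahaRel K n q t (gP K n * gY K n a * gPinv K n) (gY K n b)
  | pynp (a b : Fin n) (ha : (a : ℕ) = n - 1) (hb : (b : ℕ) = 0) :
      DahaRel K n q t (gP K n * gY K n a * gPinv K n)
        (sc K n ((q⁻¹ : Kˣ) : K) * gY K n b)

/-- The double affine Hecke algebra `H_{q,t}(GL_n)`. -/
abbrev DAHA (K : Type*) [Field K] (n : ℕ) (q t : Kˣ) := RingQuot (DahaRel K n q t)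

def Telt (K : Type*) [Field K] (n : ℕ) (q t : Kˣ) (i : ZMod n) : DAHA K n q t :=
  RingQuot.mkAlgHom K (DahaRel K n q t) (gT K n i)
def Pelt (K : Type*) [Field K] (n : ℕ) (q t : Kˣ) : DAHA K n q t :=
  RingQuot.mkAlgHom K (DahaRel K n q t) (gP K n)
def Pinvelt (K : Type*) [Field K] (n : ℕ) (q t : Kˣ) : DAHA K n q t :=
  RingQuot.mkAlgHom K (DahaRel K n q t) (gPinv K n)
def Yelt (K : Type*) [Field K] (n : ℕ) (q t : Kˣ) (i : Fin n) : DAHA K n q t :=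
  RingQuot.mkAlgHom K (DahaRel K n q t) (gY K n i)
def Yinvelt (K : Type*) [Field K] (n : ℕ) (q t : Kˣ) (i : Fin n) : DAHA K n q t :=
  RingQuot.mkAlgHom K (DahaRel K n q t) (gYinv K n i)

/-- The weight space `M[z] = {v ∈ M : Y_i v = z_i v for i = 1,…,n}` of an
`H_{q,t}(GL_n)`-module `M`, for a weight `z ∈ (Kˣ)^n` (here the `Fin` index `a`
corresponds to the pair `(Y_{a+1}, z_{a+1})`). -/
def wtSet (K : Type*) [Field K] (n : ℕ) (q t : Kˣ) (M : Type*) [AddCommGroup M]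
    [Module (DAHA K n q t) M] (z : Fin n → Kˣ) : Set M :=
  {v | ∀ i : Fin n, Yelt K n q t i • v = algebraMap K (DAHA K n q t) ((z i : K)) • v}

/-- The action of `s_0` on weights:
`s_0 · (a_1, …, a_n) = (q a_n, a_2, …, a_{n−1}, q⁻¹ a_1)`. -/
def s0Act (K : Type*) [Field K] (n : ℕ) (hn : 2 ≤ n) (q : Kˣ) (z : Fin n → Kˣ) :
    Fin n → Kˣ :=
  fun j => if (j : ℕ) = 0 then q * z ⟨n - 1, by omega⟩
           else if (j : ℕ) = n - 1 then q⁻¹ * z ⟨0, by omega⟩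
           else z j

/-- The action of `π` on weights: `π · (a_1, …, a_n) = (q a_n, a_1, …, a_{n−1})`. -/
def piActW (K : Type*) [Field K] (n : ℕ) (hn : 2 ≤ n) (q : Kˣ) (z : Fin n → Kˣ) :
    Fin n → Kˣ :=
  fun j => if (j : ℕ) = 0 then q * z ⟨n - 1, by omega⟩
           else z ⟨(j : ℕ) - 1, by have := j.isLt; omega⟩

section Combinatorics

/-- The simple reflection of the affine symmetric group swapping `k` and `k + 1` for every
integer `k` congruent to `j` modulo `n`. -/
def affSwap (n : ℕ) (j k : ℤ) : ℤ :=
  if (k : ZMod n) = j then k + 1 else if (k : ZMod n) = j + 1 then k - 1 else k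

lemma ZMod.one_ne_zero_of_two_le {n : ℕ} (hn : 2 ≤ n) : (1 : ZMod n) ≠ 0 := by
  have : Fact (1 < n) := ⟨hn⟩
  exact one_ne_zero

lemma ZMod.two_ne_zero_of_three_le {n : ℕ} (hn : 3 ≤ n) : (2 : ZMod n) ≠ 0 := by
  intro h
  have h2 : ((2 : ℕ) : ZMod n) = 0 := by exact_mod_cast h
  rw [ZMod.natCast_eq_zero_iff] at h2
  have := Nat.le_of_dvd (by norm_num) h2
  omega

lemma ZMod.exists_eq_add_mul {n : ℕ} {k j : ℤ} (h : (k : ZMod n) = j) :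
    ∃ m : ℤ, k = j + m * n := by
  have h1 := (ZMod.intCast_eq_intCast_iff_dvd_sub j k n).1 h.symm
  obtain ⟨m, hm⟩ := h1
  exact ⟨m, by linarith⟩

lemma affSwap_of_eq {n : ℕ} {j k : ℤ} (h : (k : ZMod n) = j) : affSwap n j k = k + 1 := by
  simp [affSwap, h]

lemma affSwap_of_eq_add_one {n : ℕ} (hn : 2 ≤ n) {j k : ℤ} (h : (k : ZMod n) = j + 1) :
    affSwap n j k = k - 1 := by
  have := ZMod.one_ne_zero_of_two_le hn
  simp [affSwap, h, this]

lemma affSwap_self (n : ℕ) (j : ℤ) : affSwap n j j = j + 1 := affSwap_of_eq rfl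

lemma affSwap_add_one {n : ℕ} (hn : 2 ≤ n) (j : ℤ) : affSwap n j (j + 1) = j := by
  rw [affSwap_of_eq_add_one hn (by push_cast; rfl), add_sub_cancel_right]

lemma affSwap_of_ne {n : ℕ} {j k : ℤ} (h1 : (k : ZMod n) ≠ j) (h2 : (k : ZMod n) ≠ j + 1) :
    affSwap n j k = k := by
  simp [affSwap, h1, h2]

lemma affSwap_add_period (n : ℕ) (j k m : ℤ) :
    affSwap n j (k + m * n) = affSwap n j k + m * n := by
  unfold affSwap
  push_cast
  simp only [CharP.cast_eq_zero, mul_zero, add_zero]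
  split_ifs <;> ring

lemma affSwap_affSwap {n : ℕ} (hn : 2 ≤ n) (j k : ℤ) : affSwap n j (affSwap n j k) = k := by
  by_cases h0 : (k : ZMod n) = j
  · rw [affSwap_of_eq h0, affSwap_of_eq_add_one hn (by push_cast; rw [h0]), add_sub_cancel_right]
  by_cases h1 : (k : ZMod n) = j + 1
  · rw [affSwap_of_eq_add_one hn h1, affSwap_of_eq (by push_cast; rw [h1]; ring), sub_add_cancel]
  rw [affSwap_of_ne h0 h1, affSwap_of_ne h0 h1]

lemma affSwap_comp_self {n : ℕ} (hn : 2 ≤ n) (j : ℤ) :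
    affSwap n j ∘ affSwap n j = id := funext fun k => affSwap_affSwap hn j k

lemma affSwap_congr {n : ℕ} {j k : ℤ} (h : (j : ZMod n) = k) : affSwap n j = affSwap n k := by
  funext l
  simp [affSwap, h]

lemma affSwap_injective {n : ℕ} (hn : 2 ≤ n) (j : ℤ) : Function.Injective (affSwap n j) :=
  fun a b h => by rw [← affSwap_affSwap hn j a, h, affSwap_affSwap hn]

lemma affSwap_comm {n : ℕ} {j k : ℤ} (h0 : (k : ZMod n) ≠ j)
    (h1 : (k : ZMod n) ≠ j + 1) (h2 : (j : ZMod n) ≠ k + 1) :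
    affSwap n j ∘ affSwap n k = affSwap n k ∘ affSwap n j := by
  funext l
  simp only [Function.comp, affSwap]
  split_ifs <;> push_cast at * <;> grind

lemma affSwap_add_two {n : ℕ} (hn : 3 ≤ n) (j : ℤ) : affSwap n j (j + 2) = j + 2 := by
  have := ZMod.one_ne_zero_of_two_le (by omega : 2 ≤ n)
  have := ZMod.two_ne_zero_of_three_le hn
  refine affSwap_of_ne (by simpa) fun h => ‹(1 : ZMod n) ≠ 0› ?_
  push_cast at h
  linear_combination h

lemma affSwap_succ_apply {n : ℕ} (hn : 3 ≤ n) (j : ℤ) : affSwap n (j + 1) j = j := by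
  have := ZMod.one_ne_zero_of_two_le (by omega : 2 ≤ n)
  have := ZMod.two_ne_zero_of_three_le hn
  refine affSwap_of_ne (by simpa) fun h => ‹(2 : ZMod n) ≠ 0› ?_
  push_cast at h
  linear_combination -h

lemma affSwap_succ_apply_add_one (n : ℕ) (j : ℤ) : affSwap n (j + 1) (j + 1) = j + 2 := by
  rw [affSwap_self]; ring

lemma affSwap_succ_apply_add_two {n : ℕ} (hn : 2 ≤ n) (j : ℤ) :
    affSwap n (j + 1) (j + 2) = j + 1 := by
  convert affSwap_add_one hn (j + 1) using 2; ring

lemma affSwap_braid {n : ℕ} (hn : 3 ≤ n) (j : ℤ) :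
    affSwap n j ∘ affSwap n (j + 1) ∘ affSwap n j
      = affSwap n (j + 1) ∘ affSwap n j ∘ affSwap n (j + 1) := by
  have hn2 : 2 ≤ n := by omega
  have v := And.intro (affSwap_self n j) <| And.intro (affSwap_add_one hn2 j) <|
    And.intro (affSwap_add_two hn j) <| And.intro (affSwap_succ_apply hn j) <|
    And.intro (affSwap_succ_apply_add_one n j) (affSwap_succ_apply_add_two hn2 j)
  funext l
  by_cases h0 : (l : ZMod n) = j
  · obtain ⟨m, rfl⟩ := ZMod.exists_eq_add_mul h0
    simp [affSwap_add_period, v]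
  by_cases h1 : (l : ZMod n) = j + 1
  · obtain ⟨m, rfl⟩ := ZMod.exists_eq_add_mul (j := j + 1) (by push_cast; exact h1)
    simp [affSwap_add_period, v]
  by_cases h2 : (l : ZMod n) = j + 2
  · obtain ⟨m, rfl⟩ := ZMod.exists_eq_add_mul (j := j + 2) (by push_cast; exact h2)
    simp [affSwap_add_period, v]
  have e0 := affSwap_of_ne h0 h1
  have e1 : affSwap n (j + 1) l = l :=
    affSwap_of_ne (by push_cast; exact h1) (by push_cast; grind)
  simp [e0, e1]

/-- A simple reflection reverses the order of `a < b` only if they are the adjacent integers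
that it swaps. -/
lemma affSwap_lt_or {n : ℕ} (hn : 2 ≤ n) (j : ℤ) {a b : ℤ} (hab : a < b) :
    affSwap n j a < affSwap n j b ∨ ((a : ZMod n) = j ∧ b = a + 1) := by
  have := ZMod.one_ne_zero_of_two_le hn
  have hne : affSwap n j a ≠ affSwap n j b := fun h => hab.ne (affSwap_injective hn j h)
  unfold affSwap at *
  split_ifs at * <;> first | omega | skip
  all_goals grind

/-- A function on the integers that is quasi-periodic with multiplier `q⁻¹`, with nonzero
values. -/
structure QuasiPeriodic {K : Type*} [Field K] (n : ℕ) (q : Kˣ) (y : ℤ → K) : Prop where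
  ne_zero : ∀ k, y k ≠ 0
  add_period : ∀ k m : ℤ, y (k + m * n) = ((q : K) ^ m)⁻¹ * y k

/-- An injective map of the integers commuting with translation by `n`. -/
structure IsAffinePerm (n : ℕ) (g : ℤ → ℤ) : Prop where
  inj : Function.Injective g
  add_period : ∀ k m : ℤ, g (k + m * n) = g k + m * n

lemma IsAffinePerm.comp_affSwap {n : ℕ} (hn : 2 ≤ n) {g : ℤ → ℤ} (hg : IsAffinePerm n g)
    (j : ℤ) : IsAffinePerm n (g ∘ affSwap n j) where
  inj := hg.inj.comp (affSwap_injective hn j)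
  add_period k m := by simp [affSwap_add_period, hg.add_period]

lemma isAffinePerm_affSwap {n : ℕ} (hn : 2 ≤ n) (j : ℤ) : IsAffinePerm n (affSwap n j) where
  inj := affSwap_injective hn j
  add_period := affSwap_add_period n j

lemma QuasiPeriodic.comp {K : Type*} [Field K] {n : ℕ} {q : Kˣ} {y : ℤ → K}
    (hy : QuasiPeriodic n q y) {g : ℤ → ℤ} (hg : IsAffinePerm n g) :
    QuasiPeriodic n q (y ∘ g) where
  ne_zero k := hy.ne_zero _
  add_period k m := by simp [hg.add_period, hy.add_period]

lemma QuasiPeriodic.eq_of_congr {K : Type*} [Field K] {n : ℕ} {q : Kˣ} {y : ℤ → K}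
    (hq : ∀ m : ℕ, 1 ≤ m → q ^ m ≠ 1) (hy : QuasiPeriodic n q y) {a b : ℤ}
    (h : (a : ZMod n) = b) (hab : y a = y b) : a = b := by
  obtain ⟨m, rfl⟩ := ZMod.exists_eq_add_mul h
  rw [hy.add_period] at hab
  have h1 : (q : K) ^ m = 1 := by
    have := mul_right_cancel₀ (hy.ne_zero b) (hab.trans (one_mul _).symm)
    simpa using this
  have h2 : q ^ m = 1 := by
    ext; push_cast; exact h1
  have h3 : m = 0 := by
    by_contra hm
    refine hq m.natAbs (by omega) ?_
    rcases Int.natAbs_eq m with h | h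
    · rw [h] at h2; simpa using h2
    · rw [h] at h2; simpa using h2
  simp [h3]

/-- An injective map preserving `y`, other than the identity, reverses the order of two integers
with the same value of `y`. -/
lemma exists_inversion_of_comp_eq {K : Type*} [Field K] {n : ℕ} (hn : 2 ≤ n) {q : Kˣ}
    {y : ℤ → K} (hq : ∀ m : ℕ, 1 ≤ m → q ^ m ≠ 1) (hy : QuasiPeriodic n q y) {u : ℤ → ℤ}
    (hu : Function.Injective u) (hyu : y ∘ u = y) (hne : u ≠ id) :
    ∃ a b : ℤ, a < b ∧ y a = y b ∧ u b < u a := by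
  by_contra! hcon
  apply hne
  funext k
  have hyu' : ∀ l, y (u l) = y l := fun l => congrFun hyu l
  have : NeZero n := ⟨by omega⟩
  let F := {l : ℤ // y l = y k}
  have : Finite F := Finite.of_injective (fun l : F => ((l : ℤ) : ZMod n)) fun a b hab =>
    Subtype.ext (hy.eq_of_congr hq hab (a.2.trans b.2.symm))
  let f : F → F := fun l => ⟨u l, (hyu' l).trans l.2⟩
  have hf : StrictMono f := fun a b hab =>
    lt_of_le_of_ne (hcon a b hab (a.2.trans b.2.symm)) fun h =>
      hab.ne (Subtype.ext (hu (congrArg Subtype.val h)))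
  have h1 := hf.le_apply (x := (⟨k, rfl⟩ : F))
  have h2 := hf.apply_le (x := (⟨k, rfl⟩ : F))
  exact congrArg Subtype.val (le_antisymm h2 h1)

end Combinatorics

section Action

open Module

/-- Operators on a vector space satisfying the relations of the double affine Hecke algebra, with
the `Y`-operators indexed by all integers via `Y (k + n) = q⁻¹ Y k`, and with `T k` intertwining
`Y k` and `Y (k + 1)`. -/
structure DahaAction (K : Type*) [Field K] (n : ℕ) (q t : Kˣ) (M : Type*) [AddCommGroup M]
    [Module K M] where
  T : ZMod n → End K M
  Y : ℤ → End K M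
  P : M ≃ₗ[K] M
  hecke : ∀ i x, T i (T i x) = ((t : K) - (t : K)⁻¹) • T i x + x
  braid : ∀ i x, T i (T (i + 1) (T i x)) = T (i + 1) (T i (T (i + 1) x))
  T_comm : ∀ i j, j ≠ i + 1 → i ≠ j + 1 → ∀ x, T i (T j x) = T j (T i x)
  Y_comm : ∀ k l, Commute (Y k) (Y l)
  T_Y_T : ∀ (k : ℤ) x, T k (Y k (T k x)) = Y (k + 1) x
  T_Y : ∀ k l : ℤ, (l : ZMod n) ≠ k → (l : ZMod n) ≠ k + 1 → ∀ x, T k (Y l x) = Y l (T k x)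
  P_T : ∀ i x, P (T i x) = T (i + 1) (P x)
  P_Y : ∀ k x, P (Y k x) = Y (k + 1) (P x)

namespace DahaAction

variable {K : Type*} [Field K] {n : ℕ} {q t : Kˣ} {M : Type*} [AddCommGroup M] [Module K M]
  (D : DahaAction K n q t M)

/-- The simultaneous eigenspace of the operators `Y k` with eigenvalues `y k`. -/
def weightSpace (y : ℤ → K) : Submodule K M := ⨅ k, (D.Y k).eigenspace (y k)

lemma mem_weightSpace {y : ℤ → K} {x : M} : x ∈ D.weightSpace y ↔ ∀ k, D.Y k x = y k • x := by
  simp [weightSpace, Submodule.mem_iInf]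

lemma iSupIndep_weightSpace : iSupIndep D.weightSpace := by
  refine (End.independent_iInf_maxGenEigenspace_of_forall_mapsTo D.Y fun i j φ =>
    End.mapsTo_maxGenEigenspace_of_comm (D.Y_comm j i) φ).mono fun y =>
      iInf_mono fun k => ?_
  exact (D.Y k).genEigenspace (y k) |>.monotone le_top

/-- The operator `Y j` is diagonalizable for each `j`. -/
def Semisimple : Prop := ∀ j, ⨆ a, (D.Y j).eigenspace a = ⊤

/-- There is no proper nonzero invariant subspace spanned by weight vectors. -/
def Simple : Prop := ∀ s : Set M, (∀ x ∈ s, ∀ k, ∃ c : K, c ≠ 0 ∧ D.Y k x = c • x) →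
  (∀ i, ∀ x ∈ s, D.T i x ∈ Submodule.span K s) → (∀ x ∈ s, D.P x ∈ Submodule.span K s) →
  (∀ x ∈ s, D.P.symm x ∈ Submodule.span K s) → (∃ x ∈ s, x ≠ 0) → Submodule.span K s = ⊤

/-- A generalized eigenvector of a diagonalizable operator is an eigenvector. -/
lemma _root_.Module.End.apply_eq_smul_of_iSup_eigenspace_eq_top {f : End K M}
    (hf : ⨆ a, f.eigenspace a = ⊤) {a : K} {x : M} (hx : f (f x - a • x) = a • (f x - a • x)) :
    f x = a • x := by
  have h1 : LinearMap.range (f - algebraMap K (End K M) a) ≤ ⨆ b, ⨆ _ : b ≠ a, f.eigenspace b := by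
    rw [← Submodule.map_top, ← hf, Submodule.map_iSup]
    refine iSup_le fun b => ?_
    rintro _ ⟨w, hw, rfl⟩
    have hw' := End.mem_eigenspace_iff.1 hw
    have e : (f - algebraMap K (End K M) a) w = (b - a) • w := by
      simp [hw', sub_smul, Module.algebraMap_end_apply]
    rw [e]
    by_cases hb : b = a
    · simp [hb]
    · exact Submodule.smul_mem _ _ (Submodule.mem_iSup_of_mem b (Submodule.mem_iSup_of_mem hb hw))
  have h2 := (End.eigenspaces_iSupIndep f a).mono_right h1
  have h3 := Submodule.disjoint_def.1 h2 (f x - a • x) (End.mem_eigenspace_iff.2 hx)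
    ⟨x, by simp [Module.algebraMap_end_apply]⟩
  exact sub_eq_zero.1 h3

lemma Y_T_apply (k : ℤ) (x : M) :
    D.Y k (D.T k x) = D.T k (D.Y (k + 1) x) - ((t : K) - (t : K)⁻¹) • D.Y (k + 1) x := by
  have h := D.hecke k (D.Y k (D.T k x))
  rw [D.T_Y_T] at h
  rw [h]; module

lemma Y_add_one_T_apply (k : ℤ) (x : M) :
    D.Y (k + 1) (D.T k x) = D.T k (D.Y k x) + ((t : K) - (t : K)⁻¹) • D.Y (k + 1) x := by
  rw [← D.T_Y_T k (D.T k x), D.hecke, map_add, map_add, map_smul, map_smul, D.T_Y_T]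
  module

/-- If two adjacent weights agree then the weight space vanishes. -/
lemma eq_zero_of_mem_weightSpace (hss : D.Semisimple) (ht : ∀ m : ℕ, 1 ≤ m → t ^ m ≠ 1)
    {y : ℤ → K} {x : M} (hx : x ∈ D.weightSpace y) {j : ℤ} (hy0 : y j ≠ 0)
    (hy : y j = y (j + 1)) : x = 0 := by
  rw [mem_weightSpace] at hx
  have e1 : D.Y j (D.T j x) = y j • D.T j x - (((t : K) - (t : K)⁻¹) * y j) • x := by
    rw [Y_T_apply, hx, ← hy, map_smul]; module
  have e2 : D.Y j (D.T j x) = y j • D.T j x := by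
    apply Module.End.apply_eq_smul_of_iSup_eigenspace_eq_top (hss j)
    rw [e1, sub_sub_cancel_left, map_neg, map_smul, hx]
    module
  rw [e1, sub_eq_self] at e2
  refine (smul_eq_zero.1 e2).resolve_left (mul_ne_zero ?_ hy0)
  intro h
  refine ht 2 (by norm_num) (Units.ext ?_)
  have := t.ne_zero
  push_cast
  field_simp at h
  linear_combination h

/-- The coefficient of the identity in the intertwiner. -/
def coef (t : Kˣ) (a b : K) : K := ((t : K) - (t : K)⁻¹) * b / (a - b)

lemma coef_mul_sub {a b : K} (h : a ≠ b) :
    coef t a b * (a - b) = ((t : K) - (t : K)⁻¹) * b := by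
  have := sub_ne_zero.2 h
  rw [coef]; field_simp

lemma coef_mul_left {a b c : K} (hc : c ≠ 0) : coef t (c * a) (c * b) = coef t a b := by
  rw [coef, coef, ← mul_sub, mul_left_comm, mul_div_mul_left _ _ hc]

lemma coef_add_coef {a b : K} (h : a ≠ b) :
    coef t a b + coef t b a = -((t : K) - (t : K)⁻¹) := by
  have := sub_ne_zero.2 h
  have := sub_ne_zero.2 h.symm
  rw [coef, coef]
  field_simp
  ring

lemma coef_braid {a b c : K} (hab : a ≠ b) (hbc : b ≠ c) (hac : a ≠ c) :
    coef t a c * (((t : K) - (t : K)⁻¹) + coef t b c + coef t a b) = coef t a b * coef t b c := by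
  have := sub_ne_zero.2 hab
  have := sub_ne_zero.2 hbc
  have := sub_ne_zero.2 hac
  simp only [coef]
  field_simp
  ring

lemma one_add_coef_mul_coef {a b : K} (h : a ≠ b) :
    1 + coef t a b * coef t b a
      = (a - (t : K) ^ 2 * b) * (b - (t : K) ^ 2 * a) / (-(t : K) ^ 2 * (a - b) ^ 2) := by
  have := sub_ne_zero.2 h
  have := sub_ne_zero.2 h.symm
  have := t.ne_zero
  simp only [coef]
  have e : b - a = -(a - b) := by ring
  rw [e]
  field_simp
  ring

/-- The intertwiner at `j` on the weight space of weight `y`. -/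
def phi (y : ℤ → K) (j : ℤ) : End K M := D.T j + coef t (y j) (y (j + 1)) • (1 : End K M)

lemma phi_apply (y : ℤ → K) (j : ℤ) (x : M) :
    D.phi y j x = D.T j x + coef t (y j) (y (j + 1)) • x := by
  simp [phi]

lemma phi_congr {y : ℤ → K} (hy : QuasiPeriodic n q y) {j k : ℤ} (h : (j : ZMod n) = k) :
    D.phi y j = D.phi y k := by
  obtain ⟨m, rfl⟩ := ZMod.exists_eq_add_mul h
  have e : k + m * n + 1 = (k + 1) + m * n := by ring
  rw [phi, phi, h, e, hy.add_period, hy.add_period,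
    coef_mul_left (inv_ne_zero (zpow_ne_zero _ q.ne_zero))]

lemma phi_mem (hn : 2 ≤ n) {y : ℤ → K} (hy : QuasiPeriodic n q y) {j : ℤ}
    (hj : y j ≠ y (j + 1)) {x : M} (hx : x ∈ D.weightSpace y) :
    D.phi y j x ∈ D.weightSpace (y ∘ affSwap n j) := by
  have hx' := D.mem_weightSpace.1 hx
  have hne : ∀ k : ℤ, (j : ZMod n) = k → y k ≠ y (k + 1) := by
    intro k hk
    obtain ⟨m, rfl⟩ := ZMod.exists_eq_add_mul hk
    intro h
    apply hj
    rw [add_right_comm, hy.add_period, hy.add_period, h]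
  rw [mem_weightSpace]
  intro k
  by_cases h0 : (k : ZMod n) = j
  · rw [D.phi_congr hy h0.symm, phi_apply, Function.comp, affSwap_of_eq h0, map_add, map_smul,
      Y_T_apply, hx', hx', map_smul]
    linear_combination (norm := module) (coef_mul_sub (t := t) (hne k h0.symm)) • x
  by_cases h1 : (k : ZMod n) = j + 1
  · obtain ⟨l, rfl⟩ : ∃ l, k = l + 1 := ⟨k - 1, by ring⟩
    have h2 : (j : ZMod n) = l := by push_cast at h1; exact (add_right_cancel h1).symm
    rw [D.phi_congr hy h2, phi_apply, Function.comp, affSwap_of_eq_add_one hn h1, map_add,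
      map_smul, Y_add_one_T_apply, hx', hx', map_smul, add_sub_cancel_right]
    linear_combination (norm := module) (-coef_mul_sub (t := t) (hne l h2)) • x
  rw [phi_apply, Function.comp, affSwap_of_ne h0 h1, map_add, map_smul, ← D.T_Y j k h0 h1, hx',
    map_smul]
  module

lemma phi_phi (hn : 2 ≤ n) {y : ℤ → K} {j : ℤ} (hj : y j ≠ y (j + 1)) (x : M) :
    D.phi (y ∘ affSwap n j) j (D.phi y j x)
      = (1 + coef t (y j) (y (j + 1)) * coef t (y (j + 1)) (y j)) • x := by
  simp only [phi_apply, Function.comp, affSwap_self, affSwap_add_one hn, map_add, map_smul,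
    D.hecke]
  linear_combination (norm := module) (coef_add_coef (t := t) hj) • D.T j x

lemma phi_comm {y : ℤ → K} {j k : ℤ} (h0 : (k : ZMod n) ≠ j) (h1 : (k : ZMod n) ≠ j + 1)
    (h2 : (j : ZMod n) ≠ k + 1) (x : M) :
    D.phi (y ∘ affSwap n k) j (D.phi y k x) = D.phi (y ∘ affSwap n j) k (D.phi y j x) := by
  have e1 : affSwap n k j = j := affSwap_of_ne h0.symm h2
  have e2 : affSwap n k (j + 1) = j + 1 := affSwap_of_ne
    (by push_cast; exact h1.symm) (by push_cast; exact fun h => h0 (add_right_cancel h).symm)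
  have e3 : affSwap n j k = k := affSwap_of_ne h0 h1
  have e4 : affSwap n j (k + 1) = k + 1 := affSwap_of_ne
    (by push_cast; exact h2.symm) (by push_cast; exact fun h => h0 (add_right_cancel h))
  simp only [phi_apply, Function.comp, e1, e2, e3, e4, map_add, map_smul, D.T_comm j k h1 h2]
  module

lemma phi_braid (hn : 3 ≤ n) (hss : D.Semisimple) (ht : ∀ m : ℕ, 1 ≤ m → t ^ m ≠ 1)
    {y : ℤ → K} (hy : QuasiPeriodic n q y) (j : ℤ) {x : M} (hx : x ∈ D.weightSpace y) :
    D.phi (y ∘ affSwap n j ∘ affSwap n (j + 1)) j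
        (D.phi (y ∘ affSwap n j) (j + 1) (D.phi y j x))
      = D.phi (y ∘ affSwap n (j + 1) ∘ affSwap n j) (j + 1)
        (D.phi (y ∘ affSwap n (j + 1)) j (D.phi y (j + 1) x)) := by
  have hn2 : 2 ≤ n := by omega
  have v := And.intro (affSwap_self n j) <| And.intro (affSwap_add_one hn2 j) <|
    And.intro (affSwap_add_two hn j) <| And.intro (affSwap_succ_apply hn j) <|
    And.intro (affSwap_succ_apply_add_one n j) (affSwap_succ_apply_add_two hn2 j)
  have two : j + 1 + 1 = j + 2 := by ring
  by_cases hab : y j = y (j + 1)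
  · rw [D.eq_zero_of_mem_weightSpace hss ht hx (hy.ne_zero _) hab]; simp
  by_cases hbc : y (j + 1) = y (j + 2)
  · rw [D.eq_zero_of_mem_weightSpace hss ht hx (hy.ne_zero _) (by rw [two]; exact hbc)]; simp
  by_cases hac : y j = y (j + 2)
  · have e1 : D.phi y j x = 0 := by
      refine D.eq_zero_of_mem_weightSpace hss ht (D.phi_mem hn2 hy hab hx) (j := j + 1)
        (hy.ne_zero _) ?_
      simp [v, two, hac]
    have e2 : D.phi y (j + 1) x = 0 := by
      refine D.eq_zero_of_mem_weightSpace hss ht (D.phi_mem hn2 hy (by rwa [two]) hx) (j := j)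
        (hy.ne_zero _) ?_
      simp [v, hac]
    simp [e1, e2]
  have hb := D.braid j x
  have c := coef_braid (t := t) hab hbc hac
  simp only [phi_apply, Function.comp, two, v, map_add, map_smul, Int.cast_add, Int.cast_one,
    D.hecke, smul_add, smul_smul] 
  linear_combination (norm := module) hb + c • D.T j x - c • D.T (j + 1) x

lemma zpow_T (e : ℤ) (i : ZMod n) (x : M) : (D.P ^ e) (D.T i x) = D.T (i + e) ((D.P ^ e) x) := by
  induction e generalizing i x with
  | zero => simp
  | succ e ih =>
    rw [zpow_add_one, LinearEquiv.mul_apply, LinearEquiv.mul_apply, D.P_T, ih]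
    push_cast
    congr 2
    ring
  | pred e ih =>
    have h : D.P⁻¹ (D.T i x) = D.T (i - 1) (D.P⁻¹ x) := by
      refine D.P.injective ?_
      rw [D.P_T, sub_add_cancel, ← LinearEquiv.mul_apply, ← LinearEquiv.mul_apply D.P,
        mul_inv_cancel]
      rfl
    rw [zpow_sub_one, LinearEquiv.mul_apply, LinearEquiv.mul_apply, h, ih]
    push_cast
    congr 2
    ring

lemma zpow_Y (e k : ℤ) (x : M) : (D.P ^ e) (D.Y k x) = D.Y (k + e) ((D.P ^ e) x) := by
  induction e generalizing k x with
  | zero => simp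
  | succ e ih =>
    rw [zpow_add_one, LinearEquiv.mul_apply, LinearEquiv.mul_apply, D.P_Y, ih]
    congr 2
    ring
  | pred e ih =>
    have h : D.P⁻¹ (D.Y k x) = D.Y (k - 1) (D.P⁻¹ x) := by
      refine D.P.injective ?_
      rw [D.P_Y, sub_add_cancel, ← LinearEquiv.mul_apply, ← LinearEquiv.mul_apply D.P,
        mul_inv_cancel]
      rfl
    rw [zpow_sub_one, LinearEquiv.mul_apply, LinearEquiv.mul_apply, h, ih]
    congr 2
    ring

lemma zpow_mem {y : ℤ → K} {x : M} (hx : x ∈ D.weightSpace y) (e : ℤ) :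
    (D.P ^ e) x ∈ D.weightSpace (fun k => y (k - e)) := by
  rw [mem_weightSpace] at *
  intro k
  have := D.zpow_Y e (k - e) x
  rw [sub_add_cancel] at this
  rw [← this, hx, map_smul]

lemma zpow_phi (y : ℤ → K) (e j : ℤ) (x : M) :
    (D.P ^ e) (D.phi y j x) = D.phi (fun k => y (k - e)) (j + e) ((D.P ^ e) x) := by
  have h1 : j + e - e = j := by ring
  have h2 : j + e + 1 - e = j + 1 := by ring
  simp only [phi_apply, map_add, map_smul, zpow_T, h1, h2, Int.cast_add]

/-- `D.Reach z v l g x` says that `x` is obtained from `v`, of weight `z`, by applying a power of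
`P` followed by `l` intertwiners, each of them increasing the length of the affine permutation
`g` that records how the weight has been permuted. -/
inductive Reach (z : ℤ → K) (v : M) : ℕ → (ℤ → ℤ) → M → Prop
  | base (m : ℤ) : Reach z v 0 (fun k => k - m) ((D.P ^ m) v)
  | step {l : ℕ} {g : ℤ → ℤ} {x : M} (j : ℤ) (h : Reach z v l g x) (hj : g j < g (j + 1)) :
      Reach z v (l + 1) (g ∘ affSwap n j) (D.phi (z ∘ g) j x)

namespace Reach

variable {D} {z : ℤ → K} {v x : M} {l : ℕ} {g : ℤ → ℤ}

lemma isAffinePerm (hn : 2 ≤ n) (h : D.Reach z v l g x) : IsAffinePerm n g := by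
  induction h with
  | base m => exact ⟨fun a b h => by simpa using h, fun k l => by ring⟩
  | step j _ _ ih => exact ih.comp_affSwap hn j

lemma mem_weightSpace (hn : 2 ≤ n) (hss : D.Semisimple) (ht : ∀ m : ℕ, 1 ≤ m → t ^ m ≠ 1)
    (hz : QuasiPeriodic n q z) (hv : v ∈ D.weightSpace z) (h : D.Reach z v l g x) :
    x ∈ D.weightSpace (z ∘ g) := by
  induction h with
  | base m => exact D.zpow_mem hv m
  | @step l g x j h hj ih =>
    have hy := hz.comp (h.isAffinePerm hn)
    by_cases e : (z ∘ g) j = (z ∘ g) (j + 1)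
    · rw [D.eq_zero_of_mem_weightSpace hss ht ih (hy.ne_zero _) e, map_zero]
      exact zero_mem _
    · exact D.phi_mem hn hy e ih

lemma eq_zero_of_inversion (hn : 2 ≤ n) (hss : D.Semisimple) (ht : ∀ m : ℕ, 1 ≤ m → t ^ m ≠ 1)
    (hz : QuasiPeriodic n q z) (hv : v ∈ D.weightSpace z) (h : D.Reach z v l g x) {a b : ℤ}
    (hab : a < b) (hg : g b < g a) (hzg : z (g a) = z (g b)) : x = 0 := by
  induction h generalizing a b with
  | base m => dsimp only at hg; omega
  | @step l g x j h hj ih =>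
    suffices hx : x = 0 by rw [hx, map_zero]
    rcases affSwap_lt_or hn j hab with hlt | ⟨ha, rfl⟩
    · exact ih hlt hg hzg
    · refine D.eq_zero_of_mem_weightSpace hss ht (h.mem_weightSpace hn hss ht hz hv) (j := a)
        (hz.ne_zero _) ?_
      simp only [Function.comp, affSwap_congr ha.symm, affSwap_self, affSwap_add_one hn] at hzg
      exact hzg.symm

lemma zpow (h : D.Reach z v l g x) (e : ℤ) :
    D.Reach z v l (fun k => g (k - e)) ((D.P ^ e) x) := by
  induction h with
  | base m =>
    have := Reach.base (D := D) (z := z) (v := v) (e + m)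
    rw [zpow_add, LinearEquiv.mul_apply] at this
    convert this using 1
    funext k; ring
  | @step l g x j h hj ih =>
    have := ih.step (j + e) (by
      rwa [add_sub_cancel_right, show j + e + 1 - e = j + 1 by ring])
    rw [zpow_phi]
    refine Eq.subst (motive := fun g' => D.Reach z v (l + 1) g' _) ?_ this
    funext k
    simp only [Function.comp, affSwap]
    push_cast
    simp only [sub_eq_iff_eq_add, add_right_comm (j : ZMod n) 1 (e : ZMod n)]
    split_ifs <;> congr 1 <;> ring

lemma eq_of_reach_id (hn : 2 ≤ n) (h : D.Reach z v l id x) : x = v := by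
  generalize hg : (id : ℤ → ℤ) = g at h
  cases h with
  | base m =>
    have := congrFun hg 0
    have hm : m = 0 := by simp at this; omega
    simp [hm]
  | @step l g x j h hj =>
    have h1 := congrFun hg j
    have h2 := congrFun hg (j + 1)
    simp only [id, Function.comp, affSwap_self, affSwap_add_one hn] at h1 h2
    omega

lemma ascent_congr (hg : IsAffinePerm n g) {j k : ℤ} (h : (j : ZMod n) = k)
    (hj : g j < g (j + 1)) : g k < g (k + 1) := by
  obtain ⟨m, rfl⟩ := ZMod.exists_eq_add_mul h
  rw [add_right_comm, hg.add_period, hg.add_period] at hj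
  omega

lemma three_le_of_descents (hn : 2 ≤ n) (hg : IsAffinePerm n g) {j : ℤ}
    (h1 : g (j + 1) < g j) (h2 : g (j + 2) < g (j + 1)) : 3 ≤ n := by
  by_contra hlt
  obtain rfl : n = 2 := by omega
  have := hg.add_period j 1
  simp only [one_mul, Nat.cast_ofNat] at this
  omega

/-- The last intertwiner can be taken at any descent. -/
lemma exchange (hn : 2 ≤ n) (hss : D.Semisimple) (ht : ∀ m : ℕ, 1 ≤ m → t ^ m ≠ 1)
    (hz : QuasiPeriodic n q z) (hv : v ∈ D.weightSpace z) (h : D.Reach z v l g x) {j : ℤ}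
    (hj : g (j + 1) < g j) :
    ∃ l' x', l = l' + 1 ∧ D.Reach z v l' (g ∘ affSwap n j) x' ∧
      x = D.phi (z ∘ g ∘ affSwap n j) j x' := by
  induction l using Nat.strong_induction_on generalizing g x j with
  | _ l ih =>
  cases h with
  | base m => dsimp only at hj; omega
  | @step l g x k h hk =>
    have hg := h.isAffinePerm hn
    have cancel : ∀ i : ℤ, affSwap n i ∘ affSwap n i = id := affSwap_comp_self hn
    have cancel' : ∀ (f : ℤ → ℤ) (i : ℤ), affSwap n i ∘ affSwap n i ∘ f = f := fun f i => by
      rw [← Function.comp_assoc, cancel, Function.id_comp]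
    by_cases h0 : (k : ZMod n) = j
    · refine ⟨l, x, rfl, ?_, ?_⟩
      · rwa [affSwap_congr h0, Function.comp_assoc, cancel]
      · rw [affSwap_congr h0, Function.comp_assoc, cancel, D.phi_congr (hz.comp hg) h0]
        rfl
    by_cases h1 : (k : ZMod n) = j + 1
    · have h1' : (k : ZMod n) = (j + 1 : ℤ) := by push_cast; exact h1
      have hk' := ascent_congr hg h1' hk
      have two : j + 1 + 1 = j + 2 := by ring
      rw [D.phi_congr (hz.comp hg) h1']
      rw [affSwap_congr h1'] at hj ⊢
      have hn3 : 3 ≤ n := three_le_of_descents hn (hg.comp_affSwap hn (j + 1)) hj (by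
        simpa only [Function.comp, affSwap_succ_apply_add_one, affSwap_succ_apply_add_two hn,
          two] using hk')
      have w := And.intro (affSwap_self n j) <| And.intro (affSwap_add_one hn j) <|
        And.intro (affSwap_add_two hn3 j) <| And.intro (affSwap_succ_apply hn3 j) <|
        And.intro (affSwap_succ_apply_add_one n j) (affSwap_succ_apply_add_two hn j)
      simp only [Function.comp, two, w] at hj hk'
      obtain ⟨l₁, x₁, rfl, h₁, rfl⟩ := ih l (by omega) h (j := j) (by omega)
      obtain ⟨l₂, x₂, rfl, h₂, rfl⟩ := ih l₁ (by omega) h₁ (j := j + 1)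
        (by simp only [Function.comp, two, w]; omega)
      clear ih h h₁
      obtain ⟨f, rfl⟩ : ∃ f, g = f ∘ affSwap n (j + 1) ∘ affSwap n j :=
        ⟨g ∘ affSwap n j ∘ affSwap n (j + 1), by
          simp only [Function.comp_assoc, cancel, cancel', Function.comp_id]⟩
      simp only [Function.comp, w] at hj hk'
      simp only [Function.comp_assoc, cancel, Function.comp_id] at h₂ ⊢
      have e : affSwap n (j + 1) ∘ affSwap n j ∘ affSwap n (j + 1) ∘ affSwap n j
          = affSwap n j ∘ affSwap n (j + 1) := by
        have := congrArg (· ∘ affSwap n j) (affSwap_braid hn3 j)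
        simpa only [Function.comp_assoc, cancel, Function.comp_id] using this.symm
      refine ⟨l₂ + 1 + 1, D.phi (z ∘ f ∘ affSwap n j) (j + 1) (D.phi (z ∘ f) j x₂), rfl, ?_, ?_⟩
      · rw [e]
        exact (h₂.step j (by omega)).step (j + 1) (by simp only [Function.comp, two, w]; omega)
      · rw [e]
        exact (D.phi_braid hn3 hss ht (hz.comp (h₂.isAffinePerm hn)) j
          (h₂.mem_weightSpace hn hss ht hz hv)).symm
    by_cases h2 : (j : ZMod n) = k + 1
    · obtain ⟨i, rfl⟩ : ∃ i, j = i + 1 := ⟨j - 1, by ring⟩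
      have h2' : (k : ZMod n) = i := by push_cast at h2; exact (add_right_cancel h2).symm
      have hk' := ascent_congr hg h2' hk
      have two : i + 1 + 1 = i + 2 := by ring
      rw [D.phi_congr (hz.comp hg) h2']
      rw [affSwap_congr h2'] at hj ⊢
      have hn3 : 3 ≤ n := three_le_of_descents hn (hg.comp_affSwap hn i) (j := i)
        (by simpa only [Function.comp, affSwap_self, affSwap_add_one hn] using hk')
        (by rwa [two] at hj)
      have w := And.intro (affSwap_self n i) <| And.intro (affSwap_add_one hn i) <|
        And.intro (affSwap_add_two hn3 i) <| And.intro (affSwap_succ_apply hn3 i) <|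
        And.intro (affSwap_succ_apply_add_one n i) (affSwap_succ_apply_add_two hn i)
      simp only [Function.comp, two, w] at hj hk'
      obtain ⟨l₁, x₁, rfl, h₁, rfl⟩ := ih l (by omega) h (j := i + 1) (by rw [two]; omega)
      obtain ⟨l₂, x₂, rfl, h₂, rfl⟩ := ih l₁ (by omega) h₁ (j := i)
        (by simp only [Function.comp, w]; omega)
      clear ih h h₁
      obtain ⟨f, rfl⟩ : ∃ f, g = f ∘ affSwap n i ∘ affSwap n (i + 1) :=
        ⟨g ∘ affSwap n (i + 1) ∘ affSwap n i, by
          simp only [Function.comp_assoc, cancel, cancel', Function.comp_id]⟩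
      simp only [Function.comp, w] at hj hk'
      simp only [Function.comp_assoc, cancel, Function.comp_id] at h₂ ⊢
      have e : affSwap n i ∘ affSwap n (i + 1) ∘ affSwap n i ∘ affSwap n (i + 1)
          = affSwap n (i + 1) ∘ affSwap n i := by
        have := congrArg (· ∘ affSwap n (i + 1)) (affSwap_braid hn3 i)
        simpa only [Function.comp_assoc, cancel, Function.comp_id] using this
      refine ⟨l₂ + 1 + 1, D.phi (z ∘ f ∘ affSwap n (i + 1)) i (D.phi (z ∘ f) (i + 1) x₂), rfl,
        ?_, ?_⟩
      · rw [e]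
        exact (h₂.step (i + 1) (by rw [two]; omega)).step i
          (by simp only [Function.comp, w]; omega)
      · rw [e]
        exact D.phi_braid hn3 hss ht (hz.comp (h₂.isAffinePerm hn)) i
          (h₂.mem_weightSpace hn hss ht hz hv)
    have e1 : affSwap n k j = j := affSwap_of_ne (Ne.symm h0) h2
    have e2 : affSwap n k (j + 1) = j + 1 := affSwap_of_ne
      (by push_cast; exact Ne.symm h1) (by push_cast; exact fun h => h0 (add_right_cancel h).symm)
    have e3 : affSwap n j k = k := affSwap_of_ne h0 h1
    have e4 : affSwap n j (k + 1) = k + 1 := affSwap_of_ne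
      (by push_cast; exact Ne.symm h2) (by push_cast; exact fun h => h0 (add_right_cancel h))
    simp only [Function.comp, e1, e2] at hj
    obtain ⟨l₁, x₁, rfl, h₁, rfl⟩ := ih l (by omega) h hj
    have comm := affSwap_comm h0 h1 h2
    refine ⟨l₁ + 1, D.phi (z ∘ g ∘ affSwap n j) k x₁, rfl, ?_, ?_⟩
    · have r := h₁.step k (by simpa only [Function.comp, e3, e4] using hk)
      rw [Function.comp_assoc, comm] at r
      exact r
    · have := D.phi_comm (y := z ∘ g ∘ affSwap n j) (Ne.symm h0) h2 h1 x₁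
      simp only [Function.comp_assoc, cancel, Function.comp_id] at this ⊢
      rw [this, ← comm]

end Reach

lemma exists_eq_smul_of_reach {z : ℤ → K} {v x : M} {l : ℕ} {g : ℤ → ℤ} (hn : 2 ≤ n)
    (hss : D.Semisimple) (ht : ∀ m : ℕ, 1 ≤ m → t ^ m ≠ 1) (hz : QuasiPeriodic n q z)
    (hv : v ∈ D.weightSpace z) (h : D.Reach z v l g x) (k : ℤ) :
    ∃ c : K, c ≠ 0 ∧ D.Y k x = c • x :=
  ⟨z (g k), hz.ne_zero _, D.mem_weightSpace.1 (h.mem_weightSpace hn hss ht hz hv) k⟩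

lemma T_mem_span_of_reach {z : ℤ → K} {v x : M} {l : ℕ} {g : ℤ → ℤ} (hn : 2 ≤ n)
    (hss : D.Semisimple) (ht : ∀ m : ℕ, 1 ≤ m → t ^ m ≠ 1) (hz : QuasiPeriodic n q z)
    (hv : v ∈ D.weightSpace z) (h : D.Reach z v l g x) (j : ℤ) :
    D.T j x ∈ Submodule.span K {x | ∃ l g, D.Reach z v l g x} := by
  have hg := h.isAffinePerm hn
  have hx : x ∈ Submodule.span K {x | ∃ l g, D.Reach z v l g x} :=
    Submodule.subset_span ⟨l, g, h⟩
  suffices hphi : D.phi (z ∘ g) j x ∈ Submodule.span K {x | ∃ l g, D.Reach z v l g x} by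
    rw [phi_apply] at hphi
    exact (Submodule.add_mem_iff_left _ (Submodule.smul_mem _ _ hx)).1 hphi
  rcases lt_trichotomy (g j) (g (j + 1)) with hlt | heq | hgt
  · exact Submodule.subset_span ⟨_, _, h.step j hlt⟩
  · have := hg.inj heq
    omega
  · obtain ⟨l', x', -, h', rfl⟩ := h.exchange hn hss ht hz hv hgt
    have hx' := h'.mem_weightSpace hn hss ht hz hv
    by_cases e : (z ∘ g ∘ affSwap n j) j = (z ∘ g ∘ affSwap n j) (j + 1)
    · rw [D.eq_zero_of_mem_weightSpace hss ht hx' (hz.ne_zero _) e]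
      simp
    · have := D.phi_phi hn e x'
      simp only [Function.comp_assoc, affSwap_comp_self hn, Function.comp_id] at this
      rw [this]
      exact Submodule.smul_mem _ _ (Submodule.subset_span ⟨_, _, h'⟩)

lemma span_reach_eq_top {z : ℤ → K} {v : M} (hn : 2 ≤ n) (hs : D.Simple)
    (hss : D.Semisimple) (ht : ∀ m : ℕ, 1 ≤ m → t ^ m ≠ 1) (hz : QuasiPeriodic n q z)
    (hv : v ∈ D.weightSpace z) (hv0 : v ≠ 0) :
    Submodule.span K {x | ∃ l g, D.Reach z v l g x} = ⊤ := by
  refine hs _ ?_ ?_ ?_ ?_ ?_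
  · rintro x ⟨l, g, h⟩ k
    exact D.exists_eq_smul_of_reach hn hss ht hz hv h k
  · rintro i x ⟨l, g, h⟩
    obtain ⟨j, rfl⟩ := ZMod.intCast_surjective i
    exact D.T_mem_span_of_reach hn hss ht hz hv h j
  · rintro x ⟨l, g, h⟩
    have := h.zpow 1
    rw [zpow_one] at this
    exact Submodule.subset_span ⟨_, _, this⟩
  · rintro x ⟨l, g, h⟩
    have := h.zpow (-1)
    rw [zpow_neg_one] at this
    exact Submodule.subset_span ⟨_, _, this⟩
  · exact ⟨v, ⟨_, _, Reach.base 0⟩, hv0⟩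

/-- If the intertwiner at `i` kills some weight vector of weight `z`, then the swapped weight does
not occur. -/
lemma weightSpace_affSwap_eq_bot_of_phi_eq_zero {z : ℤ → K} {v : M} (hn : 2 ≤ n) (hs : D.Simple)
    (hss : D.Semisimple) (hq : ∀ m : ℕ, 1 ≤ m → q ^ m ≠ 1) (ht : ∀ m : ℕ, 1 ≤ m → t ^ m ≠ 1)
    (hz : QuasiPeriodic n q z) (hv : v ∈ D.weightSpace z) (hv0 : v ≠ 0) {i : ℤ}
    (hi : D.phi z i v = 0) : D.weightSpace (z ∘ affSwap n i) = ⊥ := by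
  have hle : Submodule.span K {x | ∃ l g, D.Reach z v l g x}
      ≤ ⨆ y, ⨆ _ : y ≠ z ∘ affSwap n i, D.weightSpace y := by
    rw [Submodule.span_le]
    rintro x ⟨l, g, h⟩
    by_cases hg : z ∘ g = z ∘ affSwap n i
    · suffices hx : x = 0 by rw [hx]; exact zero_mem _
      by_cases hgi : g = affSwap n i
      · subst hgi
        obtain ⟨l', x', -, h', rfl⟩ := h.exchange hn hss ht hz hv (j := i)
          (by rw [affSwap_self, affSwap_add_one hn]; omega)
        rw [affSwap_comp_self hn] at h' ⊢
        rw [h'.eq_of_reach_id hn]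
        exact hi
      · have hgp := h.isAffinePerm hn
        obtain ⟨a, b, hab, hzab, hu⟩ := exists_inversion_of_comp_eq hn hq hz
          (u := g ∘ affSwap n i) (hgp.comp_affSwap hn i).inj
          (by rw [← Function.comp_assoc, hg, Function.comp_assoc, affSwap_comp_self hn,
            Function.comp_id])
          (fun he => hgi (by
            rw [← Function.comp_id g, ← affSwap_comp_self hn i, ← Function.comp_assoc, he,
              Function.id_comp]))
        rcases affSwap_lt_or hn i hab with hlt | ⟨ha, rfl⟩
        · refine h.eq_zero_of_inversion hn hss ht hz hv hlt hu ?_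
          have e : ∀ c, z (g (affSwap n i c)) = z c := fun c => by
            have := congrFun hg (affSwap n i c)
            simpa only [Function.comp, affSwap_affSwap hn] using this
          rw [e, e, hzab]
        · exact absurd (D.eq_zero_of_mem_weightSpace hss ht hv (hz.ne_zero a) hzab) hv0
    · exact Submodule.mem_iSup_of_mem _ (Submodule.mem_iSup_of_mem hg
        (h.mem_weightSpace hn hss ht hz hv))
  rw [D.span_reach_eq_top hn hs hss ht hz hv hv0, top_le_iff] at hle
  have := D.iSupIndep_weightSpace (z ∘ affSwap n i)
  rwa [hle, disjoint_top] at this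

theorem weightSpace_affSwap_eq_bot_iff {z : ℤ → K} {v : M} (hn : 2 ≤ n) (hs : D.Simple)
    (hss : D.Semisimple) (hq : ∀ m : ℕ, 1 ≤ m → q ^ m ≠ 1) (ht : ∀ m : ℕ, 1 ≤ m → t ^ m ≠ 1)
    (hz : QuasiPeriodic n q z) (hv : v ∈ D.weightSpace z) (hv0 : v ≠ 0) (i : ℤ) :
    D.weightSpace (z ∘ affSwap n i) = ⊥ ↔
      z i = (t : K) ^ 2 * z (i + 1) ∨ z (i + 1) = (t : K) ^ 2 * z i := by
  have hne : z i ≠ z (i + 1) := fun h =>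
    hv0 (D.eq_zero_of_mem_weightSpace hss ht hv (hz.ne_zero _) h)
  have hmem := D.phi_mem hn hz hne hv
  have hphi := D.phi_phi hn hne v
  rw [one_add_coef_mul_coef hne] at hphi
  constructor
  · intro h
    rw [h, Submodule.mem_bot] at hmem
    rw [hmem, map_zero] at hphi
    have h0 := (smul_eq_zero.1 hphi.symm).resolve_right hv0
    have hden : -(t : K) ^ 2 * (z i - z (i + 1)) ^ 2 ≠ 0 :=
      mul_ne_zero (neg_ne_zero.2 (pow_ne_zero _ t.ne_zero)) (pow_ne_zero _ (sub_ne_zero.2 hne))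
    rw [div_eq_zero_iff, or_iff_left hden, mul_eq_zero, sub_eq_zero, sub_eq_zero] at h0
    exact h0
  · intro h
    have h0 : (z i - (t : K) ^ 2 * z (i + 1)) * (z (i + 1) - (t : K) ^ 2 * z i) = 0 := by
      rwa [mul_eq_zero, sub_eq_zero, sub_eq_zero]
    rw [h0, zero_div, zero_smul] at hphi
    by_cases hv1 : D.phi z i v = 0
    · exact D.weightSpace_affSwap_eq_bot_of_phi_eq_zero hn hs hss hq ht hz hv hv0 hv1
    · have := D.weightSpace_affSwap_eq_bot_of_phi_eq_zero hn hs hss hq ht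
        (hz.comp (isAffinePerm_affSwap hn i)) hmem hv1 hphi
      rw [Function.comp_assoc, affSwap_comp_self hn, Function.comp_id] at this
      rw [this, Submodule.mem_bot] at hv
      exact absurd hv hv0

theorem exists_T_apply_eq_add {z : ℤ → K} (hn : 2 ≤ n)
    (hss : D.Semisimple) (ht : ∀ m : ℕ, 1 ≤ m → t ^ m ≠ 1)
    (hz : QuasiPeriodic n q z) (i : ℤ) {v : M} (hv : v ∈ D.weightSpace z) :
    ∃ x ∈ D.weightSpace z, ∃ y ∈ D.weightSpace (z ∘ affSwap n i), D.T i v = x + y := by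
  by_cases hne : z i = z (i + 1)
  · rw [D.eq_zero_of_mem_weightSpace hss ht hv (hz.ne_zero _) hne]
    exact ⟨0, zero_mem _, 0, zero_mem _, by simp⟩
  · refine ⟨-coef t (z i) (z (i + 1)) • v, Submodule.smul_mem _ _ hv, _,
      D.phi_mem hn hz hne hv, ?_⟩
    rw [phi_apply]
    module

theorem image_P_weightSpace (z : ℤ → K) :
    (D.P : M → M) '' (D.weightSpace z) = D.weightSpace (fun k => z (k - 1)) := by
  ext x
  constructor
  · rintro ⟨w, hw, rfl⟩
    have := D.zpow_mem hw 1
    rw [zpow_one] at this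
    exact this
  · intro hx
    refine ⟨D.P.symm x, ?_, by simp⟩
    have := D.zpow_mem hx (-1)
    simp only [sub_neg_eq_add, add_sub_cancel_right, zpow_neg_one] at this
    exact this

end DahaAction

end Action

section Concrete

open Module

variable {K : Type*} [Field K] {n : ℕ} {q t : Kˣ}

/-- The residue of an integer modulo `n`, as an element of `Fin n`. -/
def finResidue (hn : 2 ≤ n) (k : ℤ) : Fin n :=
  ⟨(k % n).toNat, by have := Int.emod_lt_of_pos k (by omega : (0 : ℤ) < n); omega⟩

lemma finResidue_val (hn : 2 ≤ n) (k : ℤ) : ((finResidue hn k : ℕ) : ℤ) = k % n := by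
  have := Int.emod_nonneg k (by omega : (n : ℤ) ≠ 0)
  simp only [finResidue]
  omega

lemma finResidue_cast (hn : 2 ≤ n) (k : ℤ) : ((finResidue hn k : ℕ) : ZMod n) = k := by
  have h := congrArg (Int.cast : ℤ → ZMod n) (finResidue_val hn k)
  simpa using h

lemma finResidue_add_mul (hn : 2 ≤ n) (k m : ℤ) :
    finResidue hn (k + m * n) = finResidue hn k := by
  simp [finResidue]

lemma finResidue_coe (hn : 2 ≤ n) (a : Fin n) : finResidue hn ((a : ℕ) : ℤ) = a := by
  have := finResidue_val hn ((a : ℕ) : ℤ)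
  rw [Int.emod_eq_of_lt (by omega) (by omega)] at this
  exact Fin.ext (by exact_mod_cast this)

lemma eq_residue_add_mul (hn : 2 ≤ n) (k : ℤ) :
    k = ((finResidue hn k : ℕ) : ℤ) + (k / n) * n := by
  rw [finResidue_val, mul_comm, Int.emod_add_mul_ediv]

lemma add_mul_ediv_of_lt {r : ℕ} (hr : r < n) (m : ℤ) : ((r : ℤ) + m * n) / n = m := by
  rw [Int.add_mul_ediv_right _ _ (by omega), Int.ediv_eq_zero_of_lt (by omega) (by omega),
    zero_add]

/-- Either the residue of `k + 1` is one more than that of `k`, or it wraps around. -/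
lemma succ_cases (hn : 2 ≤ n) (k : ℤ) :
    ((finResidue hn (k + 1) : ℕ) = (finResidue hn k : ℕ) + 1 ∧ (k + 1) / n = k / n) ∨
    ((finResidue hn k : ℕ) = n - 1 ∧ (finResidue hn (k + 1) : ℕ) = 0 ∧
      (k + 1) / n = k / n + 1) := by
  have hk := eq_residue_add_mul hn k
  generalize finResidue hn k = r at hk ⊢
  generalize k / n = m at hk ⊢
  subst hk
  by_cases h : (r : ℕ) + 1 < n
  · left
    have e : ((r : ℕ) : ℤ) + m * n + 1 = (((r : ℕ) + 1 : ℕ) : ℤ) + m * n := by push_cast; ring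
    rw [e, add_mul_ediv_of_lt h, finResidue_add_mul]
    exact ⟨congrArg Fin.val (finResidue_coe hn ⟨_, h⟩), rfl⟩
  · right
    have hr : (r : ℕ) + 1 = n := by omega
    have e : ((r : ℕ) : ℤ) + m * n + 1 = ((0 : ℕ) : ℤ) + (m + 1) * n := by
      have : (((r : ℕ) + 1 : ℕ) : ℤ) = n := by exact_mod_cast hr
      push_cast at this ⊢
      linear_combination this
    rw [e, add_mul_ediv_of_lt (by omega), finResidue_add_mul]
    exact ⟨by omega, congrArg Fin.val (finResidue_coe hn ⟨0, by omega⟩), rfl⟩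

/-- Extension of a weight to a quasi-periodic function on the integers. -/
def extWeight (hn : 2 ≤ n) (q : Kˣ) (z : Fin n → Kˣ) (k : ℤ) : K :=
  ((q : K) ^ (k / n))⁻¹ * z (finResidue hn k)

lemma extWeight_quasiPeriodic (hn : 2 ≤ n) (z : Fin n → Kˣ) :
    QuasiPeriodic n q (extWeight hn q z) where
  ne_zero k := mul_ne_zero (inv_ne_zero (zpow_ne_zero _ q.ne_zero)) (Units.ne_zero _)
  add_period k m := by
    rw [extWeight, extWeight, finResidue_add_mul, Int.add_mul_ediv_right _ _ (by omega),
      zpow_add₀ q.ne_zero, mul_inv]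
    ring

lemma extWeight_coe (hn : 2 ≤ n) (z : Fin n → Kˣ) (a : Fin n) :
    extWeight hn q z ((a : ℕ) : ℤ) = z a := by
  rw [extWeight, finResidue_coe, Int.ediv_eq_zero_of_lt (by omega) (by omega)]
  simp

lemma extWeight_coe_of_val (hn : 2 ≤ n) (z : Fin n → Kˣ) {k : ℤ} {a : Fin n}
    (h : k = ((a : ℕ) : ℤ)) : extWeight hn q z k = z a := by
  rw [h, extWeight_coe]

lemma extWeight_of_eq_add (hn : 2 ≤ n) (z : Fin n → Kˣ) {k : ℤ} (a : Fin n)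
    (m : ℤ) (h : k = ((a : ℕ) : ℤ) + m * n) : extWeight hn q z k = ((q : K) ^ m)⁻¹ * z a := by
  rw [h, (extWeight_quasiPeriodic hn z).add_period, extWeight_coe]

lemma QuasiPeriodic.ext_fin (hn : 2 ≤ n) {y y' : ℤ → K} (hy : QuasiPeriodic n q y)
    (hy' : QuasiPeriodic n q y') (h : ∀ a : Fin n, y ((a : ℕ) : ℤ) = y' ((a : ℕ) : ℤ)) :
    y = y' := by
  funext k
  rw [eq_residue_add_mul hn k, hy.add_period, hy'.add_period, h]

lemma Fin.eq_of_cast_zmod_eq {a b : Fin n} (h : ((a : ℕ) : ZMod n) = ((b : ℕ) : ZMod n)) :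
    a = b := by
  rw [ZMod.natCast_eq_natCast_iff', Nat.mod_eq_of_lt a.2, Nat.mod_eq_of_lt b.2] at h
  exact Fin.ext h

lemma extWeight_swap (hn : 2 ≤ n) (z : Fin n → Kˣ) {a b : Fin n} (hab : (b : ℕ) = (a : ℕ) + 1) :
    extWeight hn q (z ∘ Equiv.swap a b) = extWeight hn q z ∘ affSwap n ((a : ℕ) : ℤ) := by
  refine QuasiPeriodic.ext_fin hn (extWeight_quasiPeriodic hn _)
    ((extWeight_quasiPeriodic hn z).comp (isAffinePerm_affSwap hn _)) fun c => ?_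
  have hba : (b : ℤ) = (a : ℕ) + 1 := by exact_mod_cast hab
  rw [extWeight_coe]
  simp only [Function.comp]
  by_cases hca : c = a
  · rw [hca, Equiv.swap_apply_left, affSwap_self, extWeight_coe_of_val hn z hba.symm]
  by_cases hcb : c = b
  · rw [hcb, Equiv.swap_apply_right, hba, affSwap_add_one hn, extWeight_coe]
  rw [Equiv.swap_apply_of_ne_of_ne hca hcb, affSwap_of_ne, extWeight_coe]
  · intro h
    exact hca (Fin.eq_of_cast_zmod_eq (by exact_mod_cast h))
  · intro h
    refine hcb (Fin.eq_of_cast_zmod_eq ?_)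
    rw [hab]
    exact_mod_cast h

lemma extWeight_neg_one (hn : 2 ≤ n) (z : Fin n → Kˣ) :
    extWeight hn q z (-1) = q * z ⟨n - 1, by omega⟩ := by
  rw [extWeight_of_eq_add hn z ⟨n - 1, by omega⟩ (-1)]
  · simp
  · push_cast [Nat.cast_sub (by omega : 1 ≤ n)]
    ring

lemma extWeight_zero (hn : 2 ≤ n) (z : Fin n → Kˣ) :
    extWeight hn q z 0 = z ⟨0, by omega⟩ :=
  extWeight_coe hn z ⟨0, by omega⟩

lemma extWeight_s0Act (hn : 2 ≤ n) (z : Fin n → Kˣ) :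
    extWeight hn q (s0Act K n hn q z) = extWeight hn q z ∘ affSwap n (-1) := by
  refine QuasiPeriodic.ext_fin hn (extWeight_quasiPeriodic hn _)
    ((extWeight_quasiPeriodic hn z).comp (isAffinePerm_affSwap hn _)) fun c => ?_
  have hlast : ((n - 1 : ℕ) : ZMod n) = -1 := by
    push_cast [Nat.cast_sub (by omega : 1 ≤ n)]
    simp
  rw [extWeight_coe, s0Act]
  simp only [Function.comp]
  by_cases h0 : (c : ℕ) = 0
  · have e : affSwap n (-1) 0 = -1 := affSwap_add_one hn (-1)
    rw [if_pos h0, h0, Nat.cast_zero, e, extWeight_neg_one]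
    push_cast
    rfl
  by_cases h1 : (c : ℕ) = n - 1
  · rw [if_neg h0, if_pos h1, h1, affSwap_of_eq (by exact_mod_cast hlast),
      extWeight_of_eq_add hn z ⟨0, by omega⟩ 1]
    · simp
    · push_cast [Nat.cast_sub (by omega : 1 ≤ n)]
      ring
  rw [if_neg h0, if_neg h1, affSwap_of_ne, extWeight_coe]
  · intro h
    refine h1 (congrArg Fin.val (Fin.eq_of_cast_zmod_eq (a := c) (b := ⟨n - 1, by omega⟩) ?_))
    rw [hlast]
    exact_mod_cast h
  · intro h
    refine h0 (congrArg Fin.val (Fin.eq_of_cast_zmod_eq (a := c) (b := ⟨0, by omega⟩) ?_))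
    simpa using h

lemma extWeight_piActW (hn : 2 ≤ n) (z : Fin n → Kˣ) :
    extWeight hn q (piActW K n hn q z) = fun k => extWeight hn q z (k - 1) := by
  refine QuasiPeriodic.ext_fin hn (extWeight_quasiPeriodic hn _)
    ((extWeight_quasiPeriodic hn z).comp (g := fun k => k - 1)
      ⟨fun a b h => by simpa using h, fun k m => by ring⟩) fun c => ?_
  rw [extWeight_coe, piActW]
  by_cases h0 : (c : ℕ) = 0
  · rw [if_pos h0, h0, Nat.cast_zero, zero_sub, extWeight_neg_one]
    push_cast
    rfl
  · rw [if_neg h0]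
    refine (extWeight_coe_of_val hn z ?_).symm
    push_cast [Nat.cast_sub (by omega : 1 ≤ (c : ℕ))]
    ring

section Relations

lemma sc_map (c : K) :
    RingQuot.mkAlgHom K (DahaRel K n q t) (sc K n c) = algebraMap K (DAHA K n q t) c :=
  AlgHom.commutes _ c

lemma Telt_hecke (i : ZMod n) :
    (Telt K n q t i - algebraMap K _ (t : K)) * (Telt K n q t i + algebraMap K _ (t : K)⁻¹)
      = 0 := by
  have h := RingQuot.mkAlgHom_rel K (DahaRel.hecke (q := q) (t := t) i)
  simp only [map_mul, map_sub, map_add, map_zero, sc_map, Units.val_inv_eq_inv_val] at h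
  exact h

lemma Telt_braid (i : ZMod n) :
    Telt K n q t i * Telt K n q t (i + 1) * Telt K n q t i
      = Telt K n q t (i + 1) * Telt K n q t i * Telt K n q t (i + 1) := by
  have h := RingQuot.mkAlgHom_rel K (DahaRel.braid (q := q) (t := t) i)
  simp only [map_mul] at h
  exact h

lemma Telt_comm {i j : ZMod n} (h1 : j ≠ i + 1) (h2 : i ≠ j + 1) :
    Telt K n q t i * Telt K n q t j = Telt K n q t j * Telt K n q t i := by
  have h := RingQuot.mkAlgHom_rel K (DahaRel.tcomm (q := q) (t := t) i j h1 h2)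
  simp only [map_mul] at h
  exact h

lemma Pelt_mul_Pinvelt : Pelt K n q t * Pinvelt K n q t = 1 := by
  have h := RingQuot.mkAlgHom_rel K (DahaRel.pPinv (K := K) (n := n) (q := q) (t := t))
  simp only [map_mul, map_one] at h
  exact h

lemma Pinvelt_mul_Pelt : Pinvelt K n q t * Pelt K n q t = 1 := by
  have h := RingQuot.mkAlgHom_rel K (DahaRel.pinvP (K := K) (n := n) (q := q) (t := t))
  simp only [map_mul, map_one] at h
  exact h

lemma Yelt_comm (i j : Fin n) :
    Yelt K n q t i * Yelt K n q t j = Yelt K n q t j * Yelt K n q t i := by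
  have h := RingQuot.mkAlgHom_rel K (DahaRel.ycomm (q := q) (t := t) i j)
  simp only [map_mul] at h
  exact h

lemma Yinvelt_mul_Yelt (i : Fin n) : Yinvelt K n q t i * Yelt K n q t i = 1 := by
  have h := RingQuot.mkAlgHom_rel K (DahaRel.yinvY (q := q) (t := t) i)
  simp only [map_mul, map_one] at h
  exact h

lemma Pelt_mul_Telt (i : ZMod n) :
    Pelt K n q t * Telt K n q t i = Telt K n q t (i + 1) * Pelt K n q t := by
  have h := RingQuot.mkAlgHom_rel K (DahaRel.ptp (q := q) (t := t) i)
  have h' : Pelt K n q t * Telt K n q t i * Pinvelt K n q t = Telt K n q t (i + 1) := by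
    simp only [map_mul] at h
    exact h
  rw [← h', mul_assoc _ _ (Pelt K n q t), Pinvelt_mul_Pelt, mul_one]

lemma Telt_Yelt_Telt {a b : Fin n} (hab : (b : ℕ) = (a : ℕ) + 1) :
    Telt K n q t (((a : ℕ) : ZMod n) + 1) * Yelt K n q t a * Telt K n q t (((a : ℕ) : ZMod n) + 1)
      = Yelt K n q t b := by
  have h := RingQuot.mkAlgHom_rel K (DahaRel.tyt (q := q) (t := t) a b hab)
  simp only [map_mul, Nat.cast_add, Nat.cast_one] at h
  exact h

lemma Telt_Yelt_Telt_zero {a b : Fin n} (ha : (a : ℕ) = n - 1) (hb : (b : ℕ) = 0) :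
    Telt K n q t 0 * Yelt K n q t a * Telt K n q t 0
      = algebraMap K _ (q : K)⁻¹ * Yelt K n q t b := by
  have h := RingQuot.mkAlgHom_rel K (DahaRel.t0yt0 (q := q) (t := t) a b ha hb)
  simp only [map_mul, sc_map, Units.val_inv_eq_inv_val] at h
  exact h

lemma Telt_Yelt_comm {i : ZMod n} {a : Fin n} (h1 : ((a : ℕ) : ZMod n) + 1 ≠ i)
    (h2 : ((a : ℕ) : ZMod n) + 1 ≠ i + 1) :
    Telt K n q t i * Yelt K n q t a = Yelt K n q t a * Telt K n q t i := by
  have h := RingQuot.mkAlgHom_rel K (DahaRel.tycomm (q := q) (t := t) i a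
    (by push_cast; exact h1) (by push_cast; exact h2))
  simp only [map_mul] at h
  exact h

lemma Pelt_mul_Yelt {a b : Fin n} (hab : (b : ℕ) = (a : ℕ) + 1) :
    Pelt K n q t * Yelt K n q t a = Yelt K n q t b * Pelt K n q t := by
  have h := RingQuot.mkAlgHom_rel K (DahaRel.pyp (q := q) (t := t) a b hab)
  have h' : Pelt K n q t * Yelt K n q t a * Pinvelt K n q t = Yelt K n q t b := by
    simp only [map_mul] at h
    exact h
  rw [← h', mul_assoc _ _ (Pelt K n q t), Pinvelt_mul_Pelt, mul_one]

lemma Pelt_mul_Yelt_last {a b : Fin n} (ha : (a : ℕ) = n - 1) (hb : (b : ℕ) = 0) :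
    Pelt K n q t * Yelt K n q t a
      = algebraMap K _ (q : K)⁻¹ * Yelt K n q t b * Pelt K n q t := by
  have h := RingQuot.mkAlgHom_rel K (DahaRel.pynp (q := q) (t := t) a b ha hb)
  have h' : Pelt K n q t * Yelt K n q t a * Pinvelt K n q t
      = algebraMap K _ (q : K)⁻¹ * Yelt K n q t b := by
    simp only [map_mul, sc_map, Units.val_inv_eq_inv_val] at h
    exact h
  rw [← h', mul_assoc _ _ (Pelt K n q t), Pinvelt_mul_Pelt, mul_one]

end Relations

variable {M : Type*} [AddCommGroup M] [Module K M] [Module (DAHA K n q t) M]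
    [IsScalarTower K (DAHA K n q t) M]

variable (M) in
/-- The operators by which the double affine Hecke algebra acts on a module. -/
def dahaAction (hn : 2 ≤ n) : DahaAction K n q t M where
  T i := Algebra.lsmul K K M (Telt K n q t (i + 1))
  Y k := ((q : K) ^ (k / n))⁻¹ • Algebra.lsmul K K M (Yelt K n q t (finResidue hn k))
  P := LinearEquiv.ofLinearMap (Algebra.lsmul K K M (Pelt K n q t))
    (Algebra.lsmul K K M (Pinvelt K n q t))
    (by
      ext x
      simp [← mul_smul, Pelt_mul_Pinvelt])
    (by
      ext x
      simp [← mul_smul, Pinvelt_mul_Pelt])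
  hecke i x := by
    have h := congrArg (· • x) (Telt_hecke (q := q) (t := t) (i + 1))
    simp only [mul_smul, sub_smul, add_smul, smul_add, algebraMap_smul, zero_smul] at h
    simp only [Algebra.lsmul_coe]
    rw [smul_comm _ (t : K)⁻¹ x, smul_inv_smul₀ t.ne_zero] at h
    generalize Telt K n q t (i + 1) • Telt K n q t (i + 1) • x = u at h ⊢
    generalize Telt K n q t (i + 1) • x = v at h ⊢
    linear_combination (norm := module) h
  braid i x := by
    simp only [Algebra.lsmul_coe, ← mul_smul, ← mul_assoc, Telt_braid]
  T_comm i j h1 h2 x := by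
    simp only [Algebra.lsmul_coe, ← mul_smul]
    rw [Telt_comm (fun h => h1 (add_right_cancel h)) fun h => h2 (add_right_cancel h)]
  Y_comm k l := by
    refine Commute.smul_left (Commute.smul_right ?_ _) _
    rw [Commute, SemiconjBy, ← map_mul, ← map_mul, Yelt_comm]
  T_Y_T k x := by
    simp only [LinearMap.smul_apply, map_smul, Algebra.lsmul_coe, ← mul_smul, ← mul_assoc]
    rcases succ_cases hn k with ⟨h1, h2⟩ | ⟨h1, h2, h3⟩
    · rw [h2, ← finResidue_cast hn k, Telt_Yelt_Telt h1]
    · have e : (k : ZMod n) + 1 = 0 := by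
        rw [← finResidue_cast hn k, h1]
        push_cast [Nat.cast_sub (by omega : 1 ≤ n)]
        simp
      rw [h3, e, Telt_Yelt_Telt_zero h1 h2, mul_smul, algebraMap_smul, smul_smul,
        zpow_add_one₀ q.ne_zero, mul_inv]
  T_Y k l h1 h2 x := by
    simp only [LinearMap.smul_apply, map_smul, Algebra.lsmul_coe, ← mul_smul]
    rw [Telt_Yelt_comm (by rw [finResidue_cast]; exact fun h => h1 (add_right_cancel h))
      (by rw [finResidue_cast]; exact fun h => h2 (add_right_cancel h))]
  P_T i x := by
    simp only [LinearEquiv.coe_ofLinearMap, Algebra.lsmul_coe, ← mul_smul, Pelt_mul_Telt]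
  P_Y k x := by
    simp only [LinearEquiv.coe_ofLinearMap, LinearMap.smul_apply, map_smul, Algebra.lsmul_coe,
      ← mul_smul]
    rcases succ_cases hn k with ⟨h1, h2⟩ | ⟨h1, h2, h3⟩
    · rw [h2, Pelt_mul_Yelt h1]
    · rw [h3, Pelt_mul_Yelt_last h1 h2, mul_assoc, mul_smul, algebraMap_smul, smul_smul,
        zpow_add_one₀ q.ne_zero, mul_inv]

lemma dahaAction_T (hn : 2 ≤ n) (i : ZMod n) (x : M) :
    (dahaAction (q := q) (t := t) M hn).T i x = Telt K n q t (i + 1) • x := rfl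

lemma dahaAction_Y (hn : 2 ≤ n) (k : ℤ) (x : M) :
    (dahaAction (q := q) (t := t) M hn).Y k x
      = ((q : K) ^ (k / n))⁻¹ • Yelt K n q t (finResidue hn k) • x := rfl

lemma dahaAction_Y_coe (hn : 2 ≤ n) (a : Fin n) (x : M) :
    (dahaAction (q := q) (t := t) M hn).Y ((a : ℕ) : ℤ) x = Yelt K n q t a • x := by
  rw [dahaAction_Y, finResidue_coe, Int.ediv_eq_zero_of_lt (by omega) (by omega)]
  simp

lemma coe_weightSpace_extWeight (hn : 2 ≤ n) (z : Fin n → Kˣ) :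
    ((dahaAction (q := q) (t := t) M hn).weightSpace (extWeight hn q z) : Set M)
      = wtSet K n q t M z := by
  ext x
  rw [SetLike.mem_coe, DahaAction.mem_weightSpace]
  constructor
  · intro h a
    have := h ((a : ℕ) : ℤ)
    rwa [extWeight_coe, dahaAction_Y_coe, ← algebraMap_smul (DAHA K n q t)] at this
  · intro h k
    rw [dahaAction_Y, h, extWeight, algebraMap_smul, mul_smul]

lemma dahaAction_semisimple (hn : 2 ≤ n)
    (hss : Submodule.span K (⋃ w : Fin n → Kˣ, wtSet K n q t M w) = ⊤) :
    (dahaAction (q := q) (t := t) M hn).Semisimple := by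
  intro j
  rw [eq_top_iff, ← hss, Submodule.span_le]
  intro x hx
  obtain ⟨w, hw⟩ := Set.mem_iUnion.1 hx
  rw [← coe_weightSpace_extWeight hn, SetLike.mem_coe, DahaAction.mem_weightSpace] at hw
  exact Submodule.mem_iSup_of_mem _ (End.mem_eigenspace_iff.2 (hw j))

/-- A subspace stable under the generators is stable under the whole algebra. -/
lemma smul_mem_of_generators_smul_mem (S : Submodule K M)
    (hS : ∀ g : DGen n, ∀ x ∈ S, RingQuot.mkAlgHom K (DahaRel K n q t) (FreeAlgebra.ι K g) • x ∈ S)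
    (h : DAHA K n q t) {x : M} (hx : x ∈ S) : h • x ∈ S := by
  obtain ⟨f, rfl⟩ := RingQuot.mkAlgHom_surjective K (DahaRel K n q t) h
  induction f using FreeAlgebra.induction generalizing x with
  | grade0 r => rw [AlgHom.commutes, algebraMap_smul]; exact S.smul_mem _ hx
  | grade1 g => exact hS g x hx
  | mul a b iha ihb => rw [map_mul, mul_smul]; exact iha (ihb hx)
  | add a b iha ihb => rw [map_add, add_smul]; exact S.add_mem (iha hx) (ihb hx)

lemma dahaAction_simple (hn : 2 ≤ n) (hsimple : IsSimpleModule (DAHA K n q t) M) :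
    (dahaAction (q := q) (t := t) M hn).Simple := by
  intro s hY hT hP hPinv ⟨v, hv, hv0⟩
  have hspan : ∀ h : DAHA K n q t, (∀ x ∈ s, h • x ∈ Submodule.span K s) →
      ∀ x ∈ Submodule.span K s, h • x ∈ Submodule.span K s := fun h hs x hx => by
    have : Submodule.span K s ≤ (Submodule.span K s).comap (Algebra.lsmul K K M h) :=
      Submodule.span_le.2 hs
    exact this hx
  let N : Submodule (DAHA K n q t) M :=
    { (Submodule.span K s).toAddSubmonoid with
      smul_mem' := fun h x hx => by
        refine smul_mem_of_generators_smul_mem (Submodule.span K s) (fun g => ?_) h hx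
        cases g with
        | T i =>
          refine hspan _ fun x hx => ?_
          have := hT (i - 1) x hx
          rwa [dahaAction_T, sub_add_cancel] at this
        | P => exact hspan _ hP
        | Pinv => exact hspan _ hPinv
        | Y a =>
          refine hspan _ fun x hx => ?_
          obtain ⟨c, -, hc⟩ := hY x hx ((a : ℕ) : ℤ)
          rw [dahaAction_Y_coe] at hc
          change Yelt K n q t a • x ∈ _
          rw [hc]
          exact Submodule.smul_mem _ _ (Submodule.subset_span hx)
        | Yinv a =>
          refine hspan _ fun x hx => ?_
          obtain ⟨c, hc0, hc⟩ := hY x hx ((a : ℕ) : ℤ)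
          rw [dahaAction_Y_coe] at hc
          change Yinvelt K n q t a • x ∈ _
          have h1 : x = c • Yinvelt K n q t a • x := by
            rw [smul_comm, ← hc, ← mul_smul, Yinvelt_mul_Yelt, one_smul]
          have h2 : Yinvelt K n q t a • x = c⁻¹ • x := by
            rw [eq_inv_smul_iff₀ hc0, ← h1]
          rw [h2]
          exact Submodule.smul_mem _ _ (Submodule.subset_span hx) }
  have hvN : v ∈ N := Submodule.subset_span (R := K) hv
  rcases eq_bot_or_eq_top N with h | h
  · rw [h, Submodule.mem_bot] at hvN
    exact absurd hvN hv0
  · rw [eq_top_iff]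
    intro x _
    have : x ∈ N := by rw [h]; trivial
    exact this

end Concrete

lemma mul_inv_eq_zpow_two_or_iff {K : Type*} [Field K] (t a b : Kˣ) :
    (a * b⁻¹ = t ^ (2 : ℤ) ∨ a * b⁻¹ = t ^ (-2 : ℤ)) ↔
      ((a : K) = (t : K) ^ 2 * b ∨ (b : K) = (t : K) ^ 2 * a) := by
  have e1 : (a * b⁻¹ = t ^ (2 : ℤ)) ↔ a = t ^ 2 * b := mul_inv_eq_iff_eq_mul
  have e2 : (a * b⁻¹ = t ^ (-2 : ℤ)) ↔ b = t ^ 2 * a := by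
    rw [mul_inv_eq_iff_eq_mul, zpow_neg, eq_inv_mul_iff_mul_eq, eq_comm]
    rfl
  rw [e1, e2, Units.ext_iff, Units.ext_iff]
  push_cast
  rfl

/-- Structure of the support of a simple `Y`-semisimple `H_{q,t}(GL_n)`-module:
for `z ∈ supp(M)`, (1) for `1 ≤ i ≤ n−1` (with `a, b` the `Fin` indices of
`z_i, z_{i+1}`), `M[s_i·z] = 0` iff `z_i/z_{i+1} ∈ {t², t⁻²}`, and
`T_i·M[z] ⊆ M[z] + M[s_i·z]`; (2) `M[s_0·z] = 0` iff `q z_n/z_1 ∈ {t², t⁻²}`,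
and `T_0·M[z] ⊆ M[z] + M[s_0·z]`; (3) `M[π·z] ≠ 0` and `π·M[z] = M[π·z]`. -/
theorem stmt13 (K : Type*) [Field K] (n : ℕ) (hn : 2 ≤ n) (q t : Kˣ)
    (hq : ∀ m : ℕ, 1 ≤ m → q ^ m ≠ 1) (ht : ∀ m : ℕ, 1 ≤ m → t ^ m ≠ 1)
    (M : Type*) [AddCommGroup M] [Module K M] [Module (DAHA K n q t) M]
    [IsScalarTower K (DAHA K n q t) M]
    (hsimple : IsSimpleModule (DAHA K n q t) M)
    (hss : Submodule.span K (⋃ w : Fin n → Kˣ, wtSet K n q t M w) = ⊤)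
    (z : Fin n → Kˣ) (hz : wtSet K n q t M z ≠ {0}) :
    (∀ a b : Fin n, (b : ℕ) = (a : ℕ) + 1 →
      ((wtSet K n q t M (z ∘ Equiv.swap a b) = {0}) ↔
        (z a * (z b)⁻¹ = t ^ (2 : ℤ) ∨ z a * (z b)⁻¹ = t ^ (-2 : ℤ))) ∧
      (∀ v ∈ wtSet K n q t M z, ∃ x ∈ wtSet K n q t M z,
        ∃ y ∈ wtSet K n q t M (z ∘ Equiv.swap a b),
          Telt K n q t (((b : ℕ) : ZMod n)) • v = x + y)) ∧
    (((wtSet K n q t M (s0Act K n hn q z) = {0}) ↔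
        (q * z ⟨n - 1, by omega⟩ * (z ⟨0, by omega⟩)⁻¹ = t ^ (2 : ℤ) ∨
          q * z ⟨n - 1, by omega⟩ * (z ⟨0, by omega⟩)⁻¹ = t ^ (-2 : ℤ))) ∧
      (∀ v ∈ wtSet K n q t M z, ∃ x ∈ wtSet K n q t M z,
        ∃ y ∈ wtSet K n q t M (s0Act K n hn q z),
          Telt K n q t 0 • v = x + y)) ∧
    ((wtSet K n q t M (piActW K n hn q z) ≠ {0}) ∧
      (fun v : M => Pelt K n q t • v) '' (wtSet K n q t M z)
        = wtSet K n q t M (piActW K n hn q z)) := by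
  have hs := dahaAction_simple (M := M) hn hsimple
  have hd := dahaAction_semisimple (M := M) hn hss
  have hzq := extWeight_quasiPeriodic (q := q) hn z
  have bot_iff : ∀ N : Submodule K M, (N : Set M) = {0} ↔ N = ⊥ := fun N => by
    rw [← Submodule.bot_coe (R := K), SetLike.coe_set_eq]
  obtain ⟨v, hv, hv0⟩ : ∃ v ∈ (dahaAction (q := q) (t := t) M hn).weightSpace
      (extWeight hn q z), v ≠ 0 := by
    rw [← coe_weightSpace_extWeight hn, Ne, bot_iff] at hz
    exact Submodule.exists_mem_ne_zero_of_ne_bot hz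
  refine ⟨fun a b hab => ⟨?_, fun w hw => ?_⟩, ⟨?_, fun w hw => ?_⟩, ?_⟩
  · have hba : ((a : ℕ) : ℤ) + 1 = ((b : ℕ) : ℤ) := by exact_mod_cast hab.symm
    rw [← coe_weightSpace_extWeight hn, bot_iff, extWeight_swap hn z hab,
      DahaAction.weightSpace_affSwap_eq_bot_iff _ hn hs hd hq ht hzq hv hv0, hba, extWeight_coe,
      extWeight_coe, mul_inv_eq_zpow_two_or_iff]
  · rw [← coe_weightSpace_extWeight hn] at hw
    obtain ⟨x, hx, y, hy, hxy⟩ :=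
      DahaAction.exists_T_apply_eq_add _ hn hd ht hzq ((a : ℕ) : ℤ) hw
    rw [dahaAction_T] at hxy
    rw [← coe_weightSpace_extWeight hn, ← coe_weightSpace_extWeight hn, extWeight_swap hn z hab]
    refine ⟨x, hx, y, hy, ?_⟩
    rw [← hxy, hab]
    push_cast
    rfl
  · rw [← coe_weightSpace_extWeight hn, bot_iff, extWeight_s0Act hn z,
      DahaAction.weightSpace_affSwap_eq_bot_iff _ hn hs hd hq ht hzq hv hv0, neg_add_cancel,
      extWeight_neg_one, extWeight_zero, mul_inv_eq_zpow_two_or_iff, Units.val_mul]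
  · rw [← coe_weightSpace_extWeight hn] at hw
    obtain ⟨x, hx, y, hy, hxy⟩ := DahaAction.exists_T_apply_eq_add _ hn hd ht hzq (-1) hw
    rw [dahaAction_T] at hxy
    rw [← coe_weightSpace_extWeight hn, ← coe_weightSpace_extWeight hn, extWeight_s0Act hn z]
    refine ⟨x, hx, y, hy, ?_⟩
    rw [← hxy]
    simp
  · have himage : (fun v : M => Pelt K n q t • v) '' (wtSet K n q t M z)
        = wtSet K n q t M (piActW K n hn q z) := by
      rw [← coe_weightSpace_extWeight hn, ← coe_weightSpace_extWeight hn, extWeight_piActW,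
        ← DahaAction.image_P_weightSpace]
      rfl
    refine ⟨fun h => hv0 ?_, himage⟩
    rw [← himage] at h
    have hPv : Pelt K n q t • v ∈ ({0} : Set M) := by
      rw [← h, ← coe_weightSpace_extWeight hn]
      exact ⟨v, hv, rfl⟩
    exact (dahaAction (q := q) (t := t) M hn).P.map_eq_zero_iff.1 hPv
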